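/- arXiv:math/0108033 — 3 statements merged into one kernel-verified Lean document; each statement's English description precedes it below -/
import Mathlib

section
/- For every d ≥ 8 there exist proper linear subspaces C, C' ⊆ 𝔽₂^d such that: C contains the all-ones vector 𝟏 = (1,1,…,1); C is integrally non-degenerate; and for any two elements x, y ∈ C, their coordinatewise product x × y lies in C'. -/
/-- `B(n, v) = Σ_{i : vᵢ = 1} nᵢ` for `n ∈ ℤ^d` and `v ∈ 𝔽₂^d`. -/
def Bmap {d : ℕ} (n : Fin d → ℤ) (v : Fin d → ZMod 2) : ℤ :=
  ∑ i ∈ Finset.univ.filter (fun i => v i = 1), n i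

/-- A binary linear code `C ⊆ 𝔽₂^d` is integrally non-degenerate if for every
nonzero `n ∈ ℤ^d` there exists `v ∈ C` with `B(n, v) ≠ 0`. -/
def IntegrallyNonDegenerate {d : ℕ} (C : Submodule (ZMod 2) (Fin d → ZMod 2)) : Prop :=
  ∀ n : Fin d → ℤ, n ≠ 0 → ∃ v ∈ C, Bmap n v ≠ 0

/-- The `[8, 4, 4]` extended Hamming code, given by its parity checks. -/
def extendedHamming : Submodule (ZMod 2) (Fin 8 → ZMod 2) where
  carrier := {v | v 0 + v 1 + v 2 + v 3 = 0 ∧ v 0 + v 1 + v 4 + v 5 = 0 ∧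
    v 0 + v 2 + v 4 + v 6 = 0 ∧ v 4 + v 5 + v 6 + v 7 = 0}
  zero_mem' := by simp
  add_mem' := by
    rintro x y ⟨h₁, h₂, h₃, h₄⟩ ⟨k₁, k₂, k₃, k₄⟩
    simp only [Set.mem_ofPred_eq, Pi.add_apply]
    refine ⟨?_, ?_, ?_, ?_⟩
    · linear_combination h₁ + k₁
    · linear_combination h₂ + k₂
    · linear_combination h₃ + k₃
    · linear_combination h₄ + k₄
  smul_mem' := by
    rintro c x ⟨h₁, h₂, h₃, h₄⟩
    simp only [Set.mem_ofPred_eq, Pi.smul_apply, smul_eq_mul]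
    refine ⟨?_, ?_, ?_, ?_⟩
    · linear_combination c * h₁
    · linear_combination c * h₂
    · linear_combination c * h₃
    · linear_combination c * h₄

theorem mem_extendedHamming {v : Fin 8 → ZMod 2} :
    v ∈ extendedHamming ↔ v 0 + v 1 + v 2 + v 3 = 0 ∧ v 0 + v 1 + v 4 + v 5 = 0 ∧
      v 0 + v 2 + v 4 + v 6 = 0 ∧ v 4 + v 5 + v 6 + v 7 = 0 :=
  Iff.rfl

/-- The code of vectors with even weight. -/
def evenWeightCode (k : ℕ) : Submodule (ZMod 2) (Fin k → ZMod 2) :=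
  LinearMap.ker (∑ i, LinearMap.proj i : (Fin k → ZMod 2) →ₗ[ZMod 2] ZMod 2)

theorem mem_evenWeightCode {k : ℕ} {v : Fin k → ZMod 2} :
    v ∈ evenWeightCode k ↔ ∑ i, v i = 0 := by
  simp [evenWeightCode]

theorem extendedHamming_mul_mem {x y : Fin 8 → ZMod 2} (hx : x ∈ extendedHamming)
    (hy : y ∈ extendedHamming) : x * y ∈ evenWeightCode 8 := by
  have key : ∀ a b c e p q r s : ZMod 2,
      a * p + b * q + c * r + (a + b + c) * (p + q + r) + e * s + (a + b + e) * (p + q + s) +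
        (a + c + e) * (p + r + s) + (b + c + e) * (q + r + s) = 0 := by
    decide
  have check : ∀ a b c e : ZMod 2, a + b + c + e = 0 → e = a + b + c := by decide
  have check' : ∀ a b c e : ZMod 2, e + (a + b + e) + (a + c + e) = b + c + e := by decide
  obtain ⟨h₁, h₂, h₃, h₄⟩ := mem_extendedHamming.1 hx
  obtain ⟨k₁, k₂, k₃, k₄⟩ := mem_extendedHamming.1 hy
  have := key (x 0) (x 1) (x 2) (x 4) (y 0) (y 1) (y 2) (y 4)
  rw [mem_evenWeightCode, Fin.sum_univ_eight]
  simp only [Pi.mul_apply]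
  rwa [check _ _ _ _ h₄, check _ _ _ _ k₄, check _ _ _ _ h₁, check _ _ _ _ h₂,
    check _ _ _ _ h₃, check _ _ _ _ k₁, check _ _ _ _ k₂, check _ _ _ _ k₃, check', check']

/-- The vectors of length `k + m` whose first `k` coordinates form a word of `C`. -/
def extendFree {k : ℕ} (m : ℕ) (C : Submodule (ZMod 2) (Fin k → ZMod 2)) :
    Submodule (ZMod 2) (Fin (k + m) → ZMod 2) :=
  C.comap (LinearMap.funLeft (ZMod 2) (ZMod 2) (Fin.castAdd m))

theorem mem_extendFree {k m : ℕ} {C : Submodule (ZMod 2) (Fin k → ZMod 2)}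
    {v : Fin (k + m) → ZMod 2} : v ∈ extendFree m C ↔ (fun i => v (Fin.castAdd m i)) ∈ C :=
  Iff.rfl

theorem append_mem_extendFree {k m : ℕ} {C : Submodule (ZMod 2) (Fin k → ZMod 2)}
    {u : Fin k → ZMod 2} (hu : u ∈ C) (w : Fin m → ZMod 2) :
    Fin.append u w ∈ extendFree m C := by
  simpa [mem_extendFree] using hu

theorem extendFree_ne_top {k m : ℕ} {C : Submodule (ZMod 2) (Fin k → ZMod 2)} (hC : C ≠ ⊤) :
    extendFree m C ≠ ⊤ := by
  refine fun h => hC (eq_top_iff.2 fun u _ => ?_)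
  have hu : Fin.append u (0 : Fin m → ZMod 2) ∈ extendFree m C := h ▸ Submodule.mem_top
  simpa [mem_extendFree] using hu

theorem Bmap_append {k m : ℕ} (n : Fin (k + m) → ℤ) (u : Fin k → ZMod 2) (w : Fin m → ZMod 2) :
    Bmap n (Fin.append u w) =
      Bmap (fun i => n (Fin.castAdd m i)) u + Bmap (fun j => n (Fin.natAdd k j)) w := by
  simp [Bmap, Finset.sum_filter, Fin.sum_univ_add]

theorem Bmap_zero {k : ℕ} (n : Fin k → ℤ) : Bmap n 0 = 0 := by
  simp [Bmap]

theorem Bmap_single {k : ℕ} (n : Fin k → ℤ) (j : Fin k) : Bmap n (Pi.single j 1) = n j := by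
  simp [Bmap, Finset.sum_filter, Pi.single_apply]

theorem IntegrallyNonDegenerate.extendFree {k m : ℕ} {C : Submodule (ZMod 2) (Fin k → ZMod 2)}
    (hC : IntegrallyNonDegenerate C) : IntegrallyNonDegenerate (extendFree m C) := by
  intro n hn
  by_contra! h
  have left : (fun i => n (Fin.castAdd m i)) = 0 := by
    by_contra hne
    obtain ⟨u, hu, hB⟩ := hC _ hne
    have := h _ (append_mem_extendFree hu 0)
    rw [Bmap_append, Bmap_zero, add_zero] at this
    exact hB this
  refine hn (funext (Fin.addCases (fun i => congrFun left i) fun j => ?_))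
  have := h _ (append_mem_extendFree C.zero_mem (Pi.single j 1))
  rwa [Bmap_append, Bmap_zero, zero_add, Bmap_single] at this

theorem integrallyNonDegenerate_extendedHamming : IntegrallyNonDegenerate extendedHamming := by
  intro n hn
  by_contra! h
  have eqn : ∀ v : Fin 8 → ZMod 2, v ∈ extendedHamming →
      ∑ i, (if v i = 1 then n i else 0) = 0 := fun v hv => by
    rw [← Finset.sum_filter]
    exact h v hv
  have h₀ := eqn ![1, 1, 1, 1, 1, 1, 1, 1] (mem_extendedHamming.2 (by decide))
  have h₁ := eqn ![0, 1, 0, 1, 0, 1, 0, 1] (mem_extendedHamming.2 (by decide))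
  have h₂ := eqn ![0, 0, 1, 1, 0, 0, 1, 1] (mem_extendedHamming.2 (by decide))
  have h₃ := eqn ![0, 1, 1, 0, 0, 1, 1, 0] (mem_extendedHamming.2 (by decide))
  have h₄ := eqn ![0, 0, 0, 0, 1, 1, 1, 1] (mem_extendedHamming.2 (by decide))
  have h₅ := eqn ![0, 1, 0, 1, 1, 0, 1, 0] (mem_extendedHamming.2 (by decide))
  have h₆ := eqn ![0, 0, 1, 1, 1, 1, 0, 0] (mem_extendedHamming.2 (by decide))
  have h₇ := eqn ![0, 1, 1, 0, 1, 0, 0, 1] (mem_extendedHamming.2 (by decide))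
  simp [Fin.sum_univ_eight] at h₀ h₁ h₂ h₃ h₄ h₅ h₆ h₇
  apply hn
  ext i
  fin_cases i <;> simp <;> omega

theorem extendedHamming_ne_top : extendedHamming ≠ ⊤ := by
  intro h
  have : (Pi.single 0 1 : Fin 8 → ZMod 2) ∈ extendedHamming := h ▸ Submodule.mem_top
  exact absurd (mem_extendedHamming.1 this) (by decide)

theorem evenWeightCode_ne_top {k : ℕ} (hk : 0 < k) : evenWeightCode k ≠ ⊤ := by
  intro h
  have : (Pi.single ⟨0, hk⟩ 1 : Fin k → ZMod 2) ∈ evenWeightCode k := h ▸ Submodule.mem_top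
  simp [mem_evenWeightCode] at this

theorem stmt_2 (d : ℕ) (hd : 8 ≤ d) :
    ∃ C C' : Submodule (ZMod 2) (Fin d → ZMod 2),
      C ≠ ⊤ ∧ C' ≠ ⊤ ∧
      (fun _ => 1 : Fin d → ZMod 2) ∈ C ∧
      IntegrallyNonDegenerate C ∧
      ∀ x ∈ C, ∀ y ∈ C, x * y ∈ C' := by
  obtain ⟨m, rfl⟩ := Nat.exists_eq_add_of_le hd
  exact ⟨extendFree m extendedHamming, extendFree m (evenWeightCode 8),
    extendFree_ne_top extendedHamming_ne_top, extendFree_ne_top (evenWeightCode_ne_top (by simp)),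
    mem_extendFree.2 (mem_extendedHamming.2 (by decide)),
    integrallyNonDegenerate_extendedHamming.extendFree,
    fun _ hx _ hy => extendedHamming_mul_mem hx hy⟩
end

section
/- The code C₈ ⊆ 𝔽₂^8 is integrally non-degenerate: for every nonzero n ∈ ℤ^8 there exists v ∈ C₈ with B(n, v) ≠ 0. -/
/-- The rows of the matrix `M` defining the code `C₈`. -/
def rowsM : Fin 4 → (Fin 8 → ZMod 2) :=
  ![![1,1,1,1,0,0,0,0], ![0,0,1,1,1,1,0,0], ![0,0,0,0,1,1,1,1], ![1,0,1,0,1,0,1,0]]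

/-- The code `C₈ ⊆ 𝔽₂^8`: the row space of the matrix `M`. -/
def C8 : Submodule (ZMod 2) (Fin 8 → ZMod 2) :=
  Submodule.span (ZMod 2) (Set.range rowsM)

theorem Bmap_eq_sum_ite {d : ℕ} (n : Fin d → ℤ) (v : Fin d → ZMod 2) :
    Bmap n v = ∑ i, if v i = 1 then n i else 0 :=
  Finset.sum_filter _ _

theorem sum_smul_rowsM_mem_C8 (c : Fin 4 → ZMod 2) : ∑ j, c j • rowsM j ∈ C8 :=
  Submodule.sum_mem _ fun j _ =>
    Submodule.smul_mem _ _ (Submodule.subset_span (Set.mem_range_self j))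

/-- The value of `B(n, ·)` on a codeword, in terms of its coordinates in the rows of `M`. -/
theorem Bmap_sum_smul_rowsM (n : Fin 8 → ℤ) (a b c d : ZMod 2) :
    Bmap n (∑ j, ![a, b, c, d] j • rowsM j) =
      (if a + d = 1 then n 0 else 0) + (if a = 1 then n 1 else 0) +
      (if a + b + d = 1 then n 2 else 0) + (if a + b = 1 then n 3 else 0) +
      (if b + c + d = 1 then n 4 else 0) + (if b + c = 1 then n 5 else 0) +
      (if c + d = 1 then n 6 else 0) + (if c = 1 then n 7 else 0) := by
  simp [Bmap_eq_sum_ite, Fin.sum_univ_eight, Fin.sum_univ_four, rowsM]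
  congr!

theorem stmt_6 :
    ∀ n : Fin 8 → ℤ, n ≠ 0 → ∃ v ∈ C8, Bmap n v ≠ 0 := by
  intro n hn
  by_contra! h
  refine hn ?_
  have key (a b c d : ZMod 2) :=
    (Bmap_sum_smul_rowsM n a b c d).symm.trans (h _ (sum_smul_rowsM_mem_C8 ![a, b, c, d]))
  have two : (1 + 1 : ZMod 2) = 0 := by decide
  have h1 := key 0 0 0 1
  have h2 := key 0 0 1 0
  have h3 := key 0 1 0 0
  have h4 := key 1 0 0 0
  have h5 := key 0 0 1 1
  have h6 := key 0 1 0 1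
  have h7 := key 0 1 1 0
  have h8 := key 0 1 1 1
  simp only [add_zero, zero_add, two, zero_ne_one, if_true, if_false] at *
  ext i
  fin_cases i <;> simp <;> omega
end

section
/- Let d ≥ 1 and let C ⊆ 𝔽₂^d be a binary linear code which contains the all-ones vector 𝟏 and is integrally non-degenerate. Let I ⊆ R_d be the ideal of the Laurent polynomial ring R_d = 𝔽₂[u₁^{±1}, …, u_d^{±1}] generated by {p_v : v ∈ C^⊥}. Then for every nonzero n ∈ ℤ^d, the element u^n − 1 does not lie in I, where u^n = u₁^{n₁}⋯u_d^{n_d}. -/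
/-- The Laurent polynomial ring `R_d = 𝔽₂[u₁^{±1}, …, u_d^{±1}]`, realized as the
group algebra of `ℤ^d` over `𝔽₂`. -/
abbrev LaurentRing (d : ℕ) := AddMonoidAlgebra (ZMod 2) (Fin d → ℤ)

/-- The monomial `u^n = u₁^{n₁}⋯u_d^{n_d}` for `n ∈ ℤ^d`. -/
noncomputable def umon {d : ℕ} (n : Fin d → ℤ) : LaurentRing d :=
  AddMonoidAlgebra.single n 1

/-- The polynomial `p_v = Σ_{i : vᵢ = 1} uᵢ` associated to `v ∈ 𝔽₂^d`. -/
noncomputable def pvL {d : ℕ} (v : Fin d → ZMod 2) : LaurentRing d :=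
  ∑ i ∈ Finset.univ.filter (fun i => v i = 1), umon (Pi.single i 1)

/-- The dot product of two vectors in `𝔽₂^d`. -/
def dotp {d : ℕ} (v w : Fin d → ZMod 2) : ZMod 2 :=
  ∑ i, v i * w i

/-- `Bmap` with a fixed second argument, as an additive homomorphism. -/
def BmapHom {d : ℕ} (w : Fin d → ZMod 2) : (Fin d → ℤ) →+ ℤ where
  toFun n := Bmap n w
  map_zero' := by simp [Bmap]
  map_add' m n := by simp [Bmap, Finset.sum_add_distrib]

theorem Bmap_single_s13 {d : ℕ} (w : Fin d → ZMod 2) (i : Fin d) :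
    Bmap (Pi.single i 1) w = if w i = 1 then 1 else 0 := by
  simp [Bmap, Pi.single_apply]

/-- The specialization `uᵢ ↦ t` if `wᵢ = 1` and `uᵢ ↦ 1` if `wᵢ = 0`. -/
noncomputable def specialize {d : ℕ} (w : Fin d → ZMod 2) :
    LaurentRing d →+* AddMonoidAlgebra (ZMod 2) ℤ :=
  AddMonoidAlgebra.mapDomainRingHom (ZMod 2) (BmapHom w)

theorem specialize_umon {d : ℕ} (w : Fin d → ZMod 2) (n : Fin d → ℤ) :
    specialize w (umon n) = AddMonoidAlgebra.single (Bmap n w) 1 := by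
  simp [specialize, umon]
  rfl

theorem specialize_umon_single {d : ℕ} (w : Fin d → ZMod 2) (i : Fin d) :
    specialize w (umon (Pi.single i 1)) =
      1 + w i • (AddMonoidAlgebra.single 1 1 - 1 : AddMonoidAlgebra (ZMod 2) ℤ) := by
  rw [specialize_umon, Bmap_single_s13]
  rcases (by decide : ∀ x : ZMod 2, x = 0 ∨ x = 1) (w i) with h | h
  · simp only [h, zero_ne_one, if_false, zero_smul, add_zero, AddMonoidAlgebra.one_def]
  · simp only [h, if_true, one_smul, add_sub_cancel]

theorem pvL_eq_sum_smul {d : ℕ} (v : Fin d → ZMod 2) :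
    pvL v = ∑ i, v i • (umon (Pi.single i 1) : LaurentRing d) := by
  rw [pvL, Finset.sum_filter]
  refine Finset.sum_congr rfl fun i _ => ?_
  rcases (by decide : ∀ x : ZMod 2, x = 0 ∨ x = 1) (v i) with h | h <;> simp [h]

theorem specialize_pvL {d : ℕ} (v w : Fin d → ZMod 2) :
    specialize w (pvL v) = dotp v (fun _ => 1) • (1 : AddMonoidAlgebra (ZMod 2) ℤ) +
      dotp v w • (AddMonoidAlgebra.single 1 1 - 1 : AddMonoidAlgebra (ZMod 2) ℤ) := by
  have hsmul (c : ZMod 2) (x : LaurentRing d) : specialize w (c • x) = c • specialize w x :=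
    ZMod.map_smul (specialize w) c x
  simp only [pvL_eq_sum_smul, map_sum, hsmul, specialize_umon_single, dotp, Finset.sum_smul,
    smul_add, Finset.sum_add_distrib, mul_one, mul_smul]

theorem stmt_13 (d : ℕ) (hd : 1 ≤ d)
    (C : Submodule (ZMod 2) (Fin d → ZMod 2))
    (hone : (fun _ => 1 : Fin d → ZMod 2) ∈ C)
    (hnd : ∀ n : Fin d → ℤ, n ≠ 0 → ∃ v ∈ C, Bmap n v ≠ 0) :
    ∀ n : Fin d → ℤ, n ≠ 0 →
      umon n - 1 ∉
        Ideal.span {p : LaurentRing d | ∃ v, (∀ w ∈ C, dotp v w = 0) ∧ p = pvL v} := by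
  intro n hn hmem
  obtain ⟨w, hw, hB⟩ := hnd n hn
  have hle : Ideal.span {p : LaurentRing d | ∃ v, (∀ w ∈ C, dotp v w = 0) ∧ p = pvL v} ≤
      RingHom.ker (specialize w) := by
    rw [Ideal.span_le]
    rintro _ ⟨v, hv, rfl⟩
    simp [RingHom.mem_ker, specialize_pvL, hv _ hone, hv _ hw]
  have hker := hle hmem
  rw [RingHom.mem_ker, map_sub, map_one, specialize_umon, sub_eq_zero,
    AddMonoidAlgebra.one_def] at hker
  exact hB (AddMonoidAlgebra.single_left_injective one_ne_zero hker)
end
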